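/- arXiv:1801.08105 — 3 statements merged into one kernel-verified Lean document; each statement's English description precedes it below -/
import Mathlib

section
/- The functions ψ₁(x) = V₀'(x) and ψ₂(x) = x·V₀'(x) + 2 both solve the linearized equation ψ''(x) + exp(V₀(x))·ψ(x) = 0 for all x ∈ ℝ. -/
noncomputable def V₀ (x : ℝ) : ℝ :=
  Real.log (4 * Real.exp (Real.sqrt 2 * x) / (1 + Real.exp (Real.sqrt 2 * x)) ^ 2)

theorem V₀_exp (x : ℝ) : Real.exp (V₀ x) =
    4 * Real.exp (Real.sqrt 2 * x) / (1 + Real.exp (Real.sqrt 2 * x)) ^ 2 := by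
  unfold V₀
  exact Real.exp_log (by positivity)

theorem E_hasDeriv (x : ℝ) : HasDerivAt (fun y : ℝ => Real.exp (Real.sqrt 2 * y))
    (Real.exp (Real.sqrt 2 * x) * Real.sqrt 2) x := by
  simpa using ((hasDerivAt_id x).const_mul (Real.sqrt 2)).exp

theorem V₀_hasDeriv (x : ℝ) : HasDerivAt V₀
    (Real.sqrt 2 * (1 - Real.exp (Real.sqrt 2 * x)) / (1 + Real.exp (Real.sqrt 2 * x))) x := by
  have hE := E_hasDeriv x
  have hp : 0 < Real.exp (Real.sqrt 2 * x) := Real.exp_pos _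
  have h := (((hE.const_mul 4).div ((hE.const_add 1).pow 2) (by simp; positivity)).log
    (by simp; positivity))
  refine h.congr_deriv ?_
  simp
  field_simp
  ring

theorem V₀_deriv : deriv V₀ = fun x : ℝ =>
    Real.sqrt 2 * (1 - Real.exp (Real.sqrt 2 * x)) / (1 + Real.exp (Real.sqrt 2 * x)) :=
  funext fun x => (V₀_hasDeriv x).deriv

theorem V₀_hasDeriv2 (x : ℝ) : HasDerivAt (deriv V₀) (-Real.exp (V₀ x)) x := by
  rw [V₀_exp, V₀_deriv]
  have hE := E_hasDeriv x
  have hp : 0 < Real.exp (Real.sqrt 2 * x) := Real.exp_pos _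
  have h := ((hE.const_sub 1).const_mul (Real.sqrt 2)).div (hE.const_add 1) (by positivity)
  refine h.congr_deriv ?_
  have h2 : Real.sqrt 2 * Real.sqrt 2 = 2 := Real.mul_self_sqrt (by norm_num)
  generalize Real.exp (Real.sqrt 2 * x) = e at *
  field_simp
  linear_combination (-2) * h2

theorem expV₀_hasDeriv (x : ℝ) : HasDerivAt (fun y => Real.exp (V₀ y))
    (Real.exp (V₀ x) * deriv V₀ x) x :=
  (V₀_hasDeriv x).differentiableAt.hasDerivAt.exp

theorem stmt_3 :
    (∀ x : ℝ,
      deriv (deriv (fun y : ℝ => deriv V₀ y)) x + Real.exp (V₀ x) * deriv V₀ x = 0) ∧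
    (∀ x : ℝ,
      deriv (deriv (fun y : ℝ => y * deriv V₀ y + 2)) x +
        Real.exp (V₀ x) * (x * deriv V₀ x + 2) = 0) := by
  have d1 : deriv (deriv V₀) = fun x => -Real.exp (V₀ x) :=
    funext fun x => (V₀_hasDeriv2 x).deriv
  have d2 : deriv (fun y : ℝ => y * deriv V₀ y + 2) =
      fun x => deriv V₀ x + x * -Real.exp (V₀ x) := by
    funext x
    have h := ((hasDerivAt_id x).mul (V₀_hasDeriv2 x)).add_const 2
    exact (h.congr_deriv (by simp)).deriv
  constructor
  · intro x
    change deriv (deriv (deriv V₀)) x + _ = 0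
    rw [d1, (expV₀_hasDeriv x).fun_neg.deriv]
    ring
  · intro x
    rw [d2]
    have h := (V₀_hasDeriv2 x).add ((hasDerivAt_id x).mul (expV₀_hasDeriv x).fun_neg)
    have h' : deriv (fun x => deriv V₀ x + x * -Real.exp (V₀ x)) x = _ := h.deriv
    rw [h']
    simp only [id]
    ring
end

section
/- Let ψ₁(x) = V₀'(x) and ψ₂(x) = x·V₀'(x) + 2. Then the Wronskian ψ₁(x)·ψ₂'(x) − ψ₁'(x)·ψ₂(x) equals 2 for every x ∈ ℝ; in particular ψ₁ and ψ₂ are linearly independent solutions of ψ'' + exp(V₀)·ψ = 0. -/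
noncomputable def ψ₁ (x : ℝ) : ℝ := deriv V₀ x

noncomputable def ψ₂ (x : ℝ) : ℝ := x * deriv V₀ x + 2

noncomputable def gAux (x : ℝ) : ℝ :=
  Real.sqrt 2 * (1 - Real.exp (Real.sqrt 2 * x)) / (1 + Real.exp (Real.sqrt 2 * x))

noncomputable def eAux (x : ℝ) : ℝ :=
  4 * Real.exp (Real.sqrt 2 * x) / (1 + Real.exp (Real.sqrt 2 * x)) ^ 2

theorem eAux_pos (x : ℝ) : 0 < eAux x := by
  unfold eAux; positivity

theorem hasDerivAt_expAux (x : ℝ) : HasDerivAt (fun x : ℝ => Real.exp (Real.sqrt 2 * x))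
    (Real.exp (Real.sqrt 2 * x) * Real.sqrt 2) x := by
  simpa using ((hasDerivAt_id x).const_mul (Real.sqrt 2)).exp

theorem hasDerivAt_eAux (x : ℝ) : HasDerivAt eAux (eAux x * gAux x) x := by
  have h := hasDerivAt_expAux x
  have hp : (1 + Real.exp (Real.sqrt 2 * x)) ≠ 0 := by positivity
  have := (h.const_mul 4).div ((h.const_add 1).pow 2) (pow_ne_zero 2 hp)
  refine HasDerivAt.congr_deriv this ?_
  unfold eAux gAux
  simp only [Pi.pow_apply]
  field_simp
  ring

theorem hasDerivAt_gAux (x : ℝ) : HasDerivAt gAux (-eAux x) x := by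
  have h := hasDerivAt_expAux x
  have hp : (1 + Real.exp (Real.sqrt 2 * x)) ≠ 0 := by positivity
  have := ((h.const_sub 1).const_mul (Real.sqrt 2)).div (h.const_add 1) hp
  refine HasDerivAt.congr_deriv this ?_
  have h2 : Real.sqrt 2 ^ 2 = 2 := Real.sq_sqrt (by norm_num)
  unfold eAux
  rw [← neg_div]
  congr 1
  linear_combination (-2 * Real.exp (Real.sqrt 2 * x)) * h2

theorem gAux_sq (x : ℝ) : gAux x ^ 2 + 2 * eAux x = 2 := by
  have hp : (1 + Real.exp (Real.sqrt 2 * x)) ≠ 0 := by positivity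
  have h2 : Real.sqrt 2 ^ 2 = 2 := Real.sq_sqrt (by norm_num)
  unfold eAux gAux
  rw [div_pow, mul_pow, h2]
  field_simp
  ring

theorem exp_V₀ (x : ℝ) : Real.exp (V₀ x) = eAux x := Real.exp_log (eAux_pos x)

theorem deriv_V₀ : deriv V₀ = gAux := by
  funext x
  have := (hasDerivAt_eAux x).log (eAux_pos x).ne'
  rw [mul_div_cancel_left₀ _ (eAux_pos x).ne'] at this
  exact this.deriv

theorem ψ₁_eq : ψ₁ = gAux := by
  funext x; simp [ψ₁, deriv_V₀]

theorem ψ₂_eq : ψ₂ = fun x => x * gAux x + 2 := by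
  funext x; simp [ψ₂, deriv_V₀]

theorem deriv_ψ₁ : deriv ψ₁ = fun x => -eAux x := by
  funext x; rw [ψ₁_eq]; exact (hasDerivAt_gAux x).deriv

theorem deriv_ψ₂ : deriv ψ₂ = fun x => gAux x + x * (-eAux x) := by
  funext x; rw [ψ₂_eq]
  have := ((hasDerivAt_id x).mul (hasDerivAt_gAux x)).add_const 2
  refine (HasDerivAt.congr_deriv this ?_).deriv
  simp

theorem stmt_4 :
    (∀ x : ℝ, ψ₁ x * deriv ψ₂ x - deriv ψ₁ x * ψ₂ x = 2) ∧
    (∀ x : ℝ, deriv (deriv ψ₁) x + Real.exp (V₀ x) * ψ₁ x = 0) ∧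
    (∀ x : ℝ, deriv (deriv ψ₂) x + Real.exp (V₀ x) * ψ₂ x = 0) ∧
    ∀ α β : ℝ, (∀ x : ℝ, α * ψ₁ x + β * ψ₂ x = 0) → α = 0 ∧ β = 0 := by
  refine ⟨fun x => ?_, fun x => ?_, fun x => ?_, fun α β h => ?_⟩
  · rw [deriv_ψ₁, deriv_ψ₂, ψ₁_eq, ψ₂_eq]
    linear_combination gAux_sq x
  · rw [deriv_ψ₁, exp_V₀, ψ₁_eq, (hasDerivAt_eAux x).fun_neg.deriv]
    ring
  · rw [deriv_ψ₂, exp_V₀, ψ₂_eq]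
    have := (hasDerivAt_gAux x).add ((hasDerivAt_id x).mul (hasDerivAt_eAux x).fun_neg)
    have h2 : HasDerivAt (fun x => gAux x + x * (-eAux x))
        (-eAux x + (-eAux x + x * (-(eAux x * gAux x)))) x := by
      refine HasDerivAt.congr_deriv this ?_
      simp
    rw [h2.deriv]
    ring
  · rw [ψ₁_eq, ψ₂_eq] at h
    have g0 : gAux 0 = 0 := by simp [gAux]
    have hb : β = 0 := by simpa [g0] using h 0
    refine ⟨?_, hb⟩
    have h1 := h 1
    rw [hb, zero_mul, add_zero] at h1
    refine (mul_eq_zero.mp h1).resolve_right ?_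
    have he : 1 < Real.exp (Real.sqrt 2 * 1) := Real.one_lt_exp_iff.mpr (by positivity)
    unfold gAux
    exact div_ne_zero (mul_ne_zero (by positivity) (by linarith)) (by positivity)
end

section
/- (Classification of the one-dimensional bubble.) Let u : ℝ → ℝ be twice continuously differentiable with u''(x) + exp(u(x)) = 0 for all x ∈ ℝ and ∫_{-∞}^{∞} exp(u(x)) dx < ∞. Then there exist μ > 0 and h ∈ ℝ such that u(x) = 2·log μ + V₀(μ·(x − h)) for all x ∈ ℝ. -/
open MeasureTheory

theorem stmt_18 (u : ℝ → ℝ) (hu : ContDiff ℝ 2 u)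
    (heq : ∀ x : ℝ, deriv (deriv u) x + Real.exp (u x) = 0)
    (hint : Integrable (fun x : ℝ => Real.exp (u x))) :
    ∃ μ > 0, ∃ h : ℝ, ∀ x : ℝ, u x = 2 * Real.log μ + V₀ (μ * (x - h)) := by
  have hu1 : ∀ x, HasDerivAt u (deriv u x) x := fun x =>
    (hu.differentiable (by norm_num) x).hasDerivAt
  have hd : ContDiff ℝ 1 (deriv u) := by
    have h2 : ContDiff ℝ (1 + 1) u := by
      rw [one_add_one_eq_two]; exact hu
    exact (contDiff_succ_iff_deriv.mp h2).2.2
  have hv1 : ∀ x, HasDerivAt (deriv u) (-Real.exp (u x)) x := fun x => by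
    have h := (hd.differentiable (by norm_num) x).hasDerivAt
    rwa [eq_neg_of_add_eq_zero_left (heq x)] at h
  generalize deriv u = v at *
  -- conserved energy
  have hE : ∀ x, v x ^ 2 + 2 * Real.exp (u x) = v 0 ^ 2 + 2 * Real.exp (u 0) := by
    have key : ∀ x, HasDerivAt (fun y => v y ^ 2 + 2 * Real.exp (u y)) 0 x := fun x => by
      have h := ((hv1 x).pow 2).add (((hu1 x).exp).const_mul 2)
      refine h.congr_deriv ?_
      push_cast
      ring
    intro x
    exact is_const_of_deriv_eq_zero (fun y => (key y).differentiableAt)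
      (fun y => (key y).deriv) x 0
  obtain ⟨c, hc, hcE⟩ : ∃ c : ℝ, 0 < c ∧ ∀ x, v x ^ 2 + 2 * Real.exp (u x) = c ^ 2 := by
    refine ⟨Real.sqrt (v 0 ^ 2 + 2 * Real.exp (u 0)), Real.sqrt_pos.mpr (by positivity), ?_⟩
    intro x
    rw [Real.sq_sqrt (by positivity)]
    exact hE x
  have habs : ∀ x, |v x| < c := fun x => by
    apply abs_lt_of_sq_lt_sq _ hc.le
    have := Real.exp_pos (u x)
    linarith [hcE x]
  have hp : ∀ x, 0 < c + v x := fun x => by linarith [(abs_lt.mp (habs x)).1]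
  have hm : ∀ x, 0 < c - v x := fun x => by linarith [(abs_lt.mp (habs x)).2]
  have key2 : ∀ x, HasDerivAt (fun y => (c - v y) / (c + v y) * Real.exp (-(c * y))) 0 x :=
    fun x => by
      have h1 := ((hv1 x).const_sub c).div ((hv1 x).const_add c) (hp x).ne'
      have h2 : HasDerivAt (fun y => Real.exp (-(c * y)))
          (Real.exp (-(c * x)) * (-(c * 1))) x :=
        (((hasDerivAt_id x).const_mul c).neg).exp
      refine (h1.mul h2).congr_deriv ?_
      have h3 : Real.exp (u x) = (c ^ 2 - v x ^ 2) / 2 := by linarith [hcE x]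
      have h4 := (hp x).ne'
      simp only [Pi.div_apply]
      rw [h3]
      field_simp
      ring
  set C := (c - v 0) / (c + v 0) with hC
  have hCpos : 0 < C := div_pos (hm 0) (hp 0)
  have hR : ∀ x, (c - v x) / (c + v x) = C * Real.exp (c * x) := fun x => by
    have h := is_const_of_deriv_eq_zero (fun y => (key2 y).differentiableAt)
      (fun y => (key2 y).deriv) x 0
    simp only [mul_zero, neg_zero, Real.exp_zero, mul_one] at h
    rw [hC, ← h, mul_assoc, ← Real.exp_add]
    simp
  have hs : (0 : ℝ) < Real.sqrt 2 := by positivity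
  have hs2 : Real.sqrt 2 ^ 2 = 2 := Real.sq_sqrt (by norm_num)
  refine ⟨c / Real.sqrt 2, by positivity, -Real.log C / c, fun x => ?_⟩
  have harg : Real.sqrt 2 * (c / Real.sqrt 2 * (x - -Real.log C / c)) = Real.log C + c * x := by
    field_simp
    ring
  have hexp : Real.exp (Real.log C + c * x) = (c - v x) / (c + v x) := by
    rw [Real.exp_add, Real.exp_log hCpos, hR]
  have h4 := hp x
  have h5 := hm x
  have h3 : Real.exp (u x) = (c ^ 2 - v x ^ 2) / 2 := by linarith [hcE x]
  unfold V₀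
  rw [harg, hexp]
  have hone : 1 + (c - v x) / (c + v x) = 2 * c / (c + v x) := by
    field_simp
    ring
  rw [hone]
  have h6 : 2 * Real.log (c / Real.sqrt 2) = Real.log ((c / Real.sqrt 2) ^ 2) := by
    rw [Real.log_pow]; norm_num
  rw [h6, ← Real.log_mul (by positivity) (by positivity), div_pow, hs2]
  rw [← Real.log_exp (u x), h3]
  congr 1
  field_simp
  ring
end
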